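/- For any ring R, the class ^⊥GI(R) is injectively resolving: it contains all injective R-modules, and for every short exact sequence 0 → X' → X → X'' → 0 of R-modules with X' ∈ ^⊥GI(R), one has X'' ∈ ^⊥GI(R) if and only if X ∈ ^⊥GI(R). -/

import Mathlib

universe u

open CategoryTheory

/-- `extVanish R n M N` asserts that `Ext_R^n(M, N) = 0`. -/
def extVanish (R : Type u) [Ring R] (n : ℕ) (M N : ModuleCat.{u} R) : Prop :=
  letI := HasDerivedCategory.standard (ModuleCat.{u} R)
  letI : HasExt.{u + 1} (ModuleCat.{u} R) := hasExt_of_hasDerivedCategory _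
  Subsingleton (Abelian.Ext M N n)

/-- A module `G` is Gorenstein projective if there is an exact sequence of projective
modules `⋯ → P i → P (i+1) → ⋯` with `G ≅ Im (d 0)` which stays exact after applying
`Hom_R(−, Q)` for every projective module `Q`. -/
def IsGorensteinProjective (R : Type u) [Ring R] (G : ModuleCat.{u} R) : Prop :=
  ∃ (P : ℤ → ModuleCat.{u} R) (d : ∀ i : ℤ, P i →ₗ[R] P (i + 1)),
    (∀ i, Module.Projective R (P i)) ∧
    (∀ i, LinearMap.range (d i) = LinearMap.ker (d (i + 1))) ∧
    Nonempty (G ≃ₗ[R] LinearMap.range (d 0)) ∧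
    ∀ (Q : ModuleCat.{u} R), Module.Projective R Q →
      ∀ (i : ℤ) (f : P (i + 1) →ₗ[R] Q), f ∘ₗ d i = 0 →
        ∃ g : P (i + 1 + 1) →ₗ[R] Q, g ∘ₗ d (i + 1) = f

/-- A module `G` is Gorenstein injective if there is an exact sequence of injective
modules `⋯ → I i → I (i+1) → ⋯` with `G ≅ Im (d 0)` which stays exact after applying
`Hom_R(E, −)` for every injective module `E`. -/
def IsGorensteinInjective (R : Type u) [Ring R] (G : ModuleCat.{u} R) : Prop :=
  ∃ (I : ℤ → ModuleCat.{u} R) (d : ∀ i : ℤ, I i →ₗ[R] I (i + 1)),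
    (∀ i, Module.Injective R (I i)) ∧
    (∀ i, LinearMap.range (d i) = LinearMap.ker (d (i + 1))) ∧
    Nonempty (G ≃ₗ[R] LinearMap.range (d 0)) ∧
    ∀ (E : ModuleCat.{u} R), Module.Injective R E →
      ∀ (i : ℤ) (f : E →ₗ[R] I (i + 1)), d (i + 1) ∘ₗ f = 0 →
        ∃ g : E →ₗ[R] I i, d i ∘ₗ g = f


universe v w

namespace CategoryTheory.ShortComplex.ShortExact

open Abelian

variable {C : Type*} [Category* C] [Abelian C] [HasExt.{w} C] {S : ShortComplex C}

/-- If `Ext¹(X, S.X₂) = 0` and every morphism `X ⟶ S.X₃` lifts to `S.X₂`, then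
`Ext¹(X, S.X₁) = 0`. -/
lemma subsingleton_ext_one_of_exists_lift (hS : S.ShortExact) (X : C)
    (_ : Subsingleton (Ext X S.X₂ 1)) (h : ∀ φ : X ⟶ S.X₃, ∃ ψ : X ⟶ S.X₂, ψ ≫ S.g = φ) :
    Subsingleton (Ext X S.X₁ 1) := by
  refine subsingleton_of_forall_eq 0 fun x ↦ ?_
  obtain ⟨y, rfl⟩ := Ext.covariant_sequence_exact₁ X hS x (Subsingleton.elim _ _) (zero_add 1)
  obtain ⟨φ, rfl⟩ := (Ext.mk₀_bijective _ _).2 y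
  obtain ⟨ψ, rfl⟩ := h φ
  rw [← Ext.mk₀_comp_mk₀, Ext.comp_assoc _ _ _ _ (zero_add 1) (by lia), hS.comp_extClass,
    Ext.comp_zero]

/-- If `Ext¹(S.X₂, Y) = 0` and every morphism `S.X₁ ⟶ Y` extends to `S.X₂`, then
`Ext¹(S.X₃, Y) = 0`. -/
lemma subsingleton_ext_one_of_exists_extension (hS : S.ShortExact) (Y : C)
    (_ : Subsingleton (Ext S.X₂ Y 1)) (h : ∀ φ : S.X₁ ⟶ Y, ∃ ψ : S.X₂ ⟶ Y, S.f ≫ ψ = φ) :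
    Subsingleton (Ext S.X₃ Y 1) := by
  refine subsingleton_of_forall_eq 0 fun x ↦ ?_
  obtain ⟨y, rfl⟩ := Ext.contravariant_sequence_exact₃ hS Y x (Subsingleton.elim _ _) (add_zero 1)
  obtain ⟨φ, rfl⟩ := (Ext.mk₀_bijective _ _).2 y
  obtain ⟨ψ, rfl⟩ := h φ
  rw [← Ext.mk₀_comp_mk₀, ← Ext.comp_assoc _ _ _ (add_zero 1) _ (by lia), hS.extClass_comp,
    Ext.zero_comp]

lemma subsingleton_ext_middle (hS : S.ShortExact) (Y : C) (n : ℕ)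
    (_ : Subsingleton (Ext S.X₁ Y n)) (_ : Subsingleton (Ext S.X₃ Y n)) :
    Subsingleton (Ext S.X₂ Y n) := by
  refine subsingleton_of_forall_eq 0 fun x ↦ ?_
  obtain ⟨y, rfl⟩ := Ext.contravariant_sequence_exact₂ hS Y x (Subsingleton.elim _ _)
  rw [Subsingleton.elim y 0, Ext.comp_zero]

lemma exists_lift_of_subsingleton_ext_one (hS : S.ShortExact) {X : C}
    (_ : Subsingleton (Ext X S.X₁ 1)) (φ : X ⟶ S.X₃) : ∃ ψ : X ⟶ S.X₂, ψ ≫ S.g = φ := by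
  obtain ⟨y, hy⟩ := Ext.covariant_sequence_exact₃ X hS (Ext.mk₀ φ) (zero_add 1)
    (Subsingleton.elim _ _)
  obtain ⟨ψ, rfl⟩ := (Ext.mk₀_bijective _ _).2 y
  exact ⟨ψ, (Ext.mk₀_bijective _ _).1 (by simpa using hy)⟩

/-- If `T` is a short exact sequence with `T.X₂` injective and `Ext¹(S.X₁, T.X₁) = 0`, then
`Ext¹(S.X₂, T.X₃) = 0` implies `Ext¹(S.X₃, T.X₃) = 0`. -/
lemma subsingleton_ext_one_of_injective_cover (hS : S.ShortExact) {T : ShortComplex C}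
    (hT : T.ShortExact) [Injective T.X₂] (h₁ : Subsingleton (Ext S.X₁ T.X₁ 1))
    (h₂ : Subsingleton (Ext S.X₂ T.X₃ 1)) : Subsingleton (Ext S.X₃ T.X₃ 1) := by
  have := hS.mono_f
  refine hS.subsingleton_ext_one_of_exists_extension _ h₂ fun φ ↦ ?_
  obtain ⟨ψ, rfl⟩ := hT.exists_lift_of_subsingleton_ext_one h₁ φ
  exact ⟨Injective.factorThru ψ S.f ≫ T.g, by simp⟩

end CategoryTheory.ShortComplex.ShortExact

section

variable {R : Type u} [Ring R]

lemma ModuleCat.shortExact_of_range_eq_ker {X₁ X₂ X₃ : ModuleCat.{v} R} {f : X₁ →ₗ[R] X₂}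
    {g : X₂ →ₗ[R] X₃} (hf : Function.Injective f) (hg : Function.Surjective g)
    (h : LinearMap.range f = LinearMap.ker g) :
    (ShortComplex.moduleCatMk f g (LinearMap.range_le_ker_iff.1 h.le)).ShortExact where
  exact := by rwa [ShortComplex.moduleCat_exact_iff_range_eq_ker]
  mono_f := (ModuleCat.mono_iff_injective _).2 hf
  epi_g := (ModuleCat.epi_iff_surjective _).2 hg

namespace IsGorensteinInjective

open Abelian

/-- A Gorenstein injective module is the cokernel of a monomorphism from a Gorenstein injective
module to an injective module. -/
lemma exists_shortExact {G : ModuleCat.{u} R} (hG : IsGorensteinInjective R G) :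
    ∃ T : ShortComplex (ModuleCat.{u} R), T.ShortExact ∧ T.X₃ = G ∧ Injective T.X₂ ∧
      IsGorensteinInjective R T.X₁ := by
  obtain ⟨I, d, hI, hd, ⟨e⟩, hE⟩ := hG
  have h0 : LinearMap.range (d (-1)) = LinearMap.ker (d 0) := hd (-1)
  let g : I 0 →ₗ[R] G := e.symm.toLinearMap ∘ₗ (d 0).rangeRestrict
  refine ⟨_, ModuleCat.shortExact_of_range_eq_ker (X₁ := ModuleCat.of R (LinearMap.range (d (-1))))
    (X₂ := I 0) (X₃ := G) (f := (LinearMap.range (d (-1))).subtype) (g := g)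
    (Submodule.subtype_injective _)
    (e.symm.surjective.comp (d 0).surjective_rangeRestrict) ?_, rfl, ?_, ?_⟩
  · rw [Submodule.range_subtype, LinearEquiv.ker_comp, LinearMap.ker_rangeRestrict]
    exact h0
  · exact (Module.injective_iff_injective_object R (I 0)).1 (hI 0)
  · let D (i j : ℤ) (h : i + 1 = j) : I i →ₗ[R] I j := h ▸ d i
    have hDd (i j k : ℤ) (h : i + 1 = j) (h' : j + 1 = k) :
        LinearMap.range (D i j h) = LinearMap.ker (D j k h') := by
      subst h h'
      exact hd i
    have hDE (E : ModuleCat.{u} R) (hE' : Module.Injective R E) (i j k : ℤ) (h : i + 1 = j)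
        (h' : j + 1 = k) (f : E →ₗ[R] I j) (hf : D j k h' ∘ₗ f = 0) :
        ∃ g : E →ₗ[R] I i, D i j h ∘ₗ g = f := by
      subst h h'
      exact hE E hE' i f hf
    exact ⟨fun i ↦ I (i - 1), fun i ↦ D (i - 1) (i + 1 - 1) (by lia), fun i ↦ hI _,
      fun i ↦ hDd _ _ _ _ _, ⟨LinearEquiv.refl R _⟩, fun E hE' i f hf ↦ hDE E hE' _ _ _ _ _ f hf⟩

lemma subsingleton_ext_one_of_injective [HasExt.{w} (ModuleCat.{u} R)] {G : ModuleCat.{u} R}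
    (hG : IsGorensteinInjective R G) (E : ModuleCat.{u} R) (hE : Module.Injective R E) :
    Subsingleton (Ext.{w} E G 1) := by
  obtain ⟨I, d, hI, hd, ⟨e⟩, hlift⟩ := hG
  let f : G →ₗ[R] I (0 + 1) := (LinearMap.range (d 0)).subtype ∘ₗ e.toLinearMap
  let g := (d (0 + 1)).rangeRestrict
  have hS := ModuleCat.shortExact_of_range_eq_ker (X₁ := G) (X₂ := I (0 + 1))
    (X₃ := ModuleCat.of R (LinearMap.range (d (0 + 1)))) (f := f) (g := g)
    ((Submodule.subtype_injective _).comp e.injective) (d (0 + 1)).surjective_rangeRestrict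
    (by rw [LinearMap.ker_rangeRestrict, LinearMap.range_comp, LinearEquiv.range,
      Submodule.map_top, Submodule.range_subtype]; exact hd 0)
  have : Injective (I (0 + 1)) := (Module.injective_iff_injective_object R _).1 (hI _)
  refine hS.subsingleton_ext_one_of_exists_lift E (Ext.subsingleton_of_injective _ (I (0 + 1)) 0) fun φ ↦ ?_
  obtain ⟨ψ, hψ⟩ := hlift E hE (0 + 1)
    ((LinearMap.range (d (0 + 1))).subtype ∘ₗ φ.hom) <| LinearMap.ext fun x ↦
      (hd (0 + 1)).le (φ.hom x).2
  exact ⟨ModuleCat.ofHom ψ, ModuleCat.hom_ext <| LinearMap.ext fun x ↦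
    Subtype.ext (LinearMap.congr_fun hψ x)⟩

end IsGorensteinInjective

end

/-- For any ring `R`, the class `^⊥GI(R)` is injectively resolving: it contains all
injective modules, and in every short exact sequence `0 → X₁ → X₂ → X₃ → 0` with
`X₁ ∈ ^⊥GI(R)`, we have `X₃ ∈ ^⊥GI(R) ↔ X₂ ∈ ^⊥GI(R)`. -/
theorem giLeftPerp_injectively_resolving (R : Type u) [Ring R] :
    (∀ I : ModuleCat.{u} R, Module.Injective R I →
      ∀ G, IsGorensteinInjective R G → extVanish R 1 I G) ∧
    (∀ (X₁ X₂ X₃ : ModuleCat.{u} R) (f : X₁ →ₗ[R] X₂) (g : X₂ →ₗ[R] X₃),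
      Function.Injective f → Function.Surjective g →
      LinearMap.range f = LinearMap.ker g →
      (∀ G, IsGorensteinInjective R G → extVanish R 1 X₁ G) →
      ((∀ G, IsGorensteinInjective R G → extVanish R 1 X₃ G) ↔
        (∀ G, IsGorensteinInjective R G → extVanish R 1 X₂ G))) := by
  let := HasDerivedCategory.standard (ModuleCat.{u} R)
  let : HasExt.{u + 1} (ModuleCat.{u} R) := hasExt_of_hasDerivedCategory _
  refine ⟨fun I hI G hG ↦ hG.subsingleton_ext_one_of_injective I hI,
    fun X₁ X₂ X₃ f g hf hg hfg h₁ ↦ ?_⟩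
  have hS := ModuleCat.shortExact_of_range_eq_ker hf hg hfg
  refine ⟨fun h₃ G hG ↦ ?_, fun h₂ G hG ↦ ?_⟩
  · exact hS.subsingleton_ext_middle G 1 (h₁ G hG) (h₃ G hG)
  · obtain ⟨T, hT, rfl, _, hT₁⟩ := hG.exists_shortExact
    exact hS.subsingleton_ext_one_of_injective_cover hT (h₁ _ hT₁) (h₂ _ hG)
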